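/- arXiv:math/9807062 — 2 statements merged into one kernel-verified Lean document; each statement's English description precedes it below -/
import Mathlib

section
/- Let a ∈ K_n, a ≠ 0, with |a|_n = q_n^N (N ∈ ℤ), let e_n be the ramification index of K_n/k, and set m = ⌊−N/e_n⌋. Then the pushforward of μ under the map K̄ → k, x ↦ ⟨a,x⟩, equals q₁^m times the restriction of the Haar measure of k (normalized so that the unit ball {z ∈ k : |z|₁ ≤ 1} has measure 1) to the ball {z ∈ k : |z|₁ ≤ q₁^{−m}}; in other words, ⟨a,·⟩ is uniformly distributed on a ball in k, so that μ is a Gaussian measure in the sense of Evans. -/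
open MeasureTheory Module
open scoped Classical

noncomputable section

/-- The topology defined by a translation-invariant "norm" function via open balls. -/
def normTopology {X : Type} [Sub X] (f : X → ℝ) : TopologicalSpace X :=
  TopologicalSpace.generateFrom
    {U | ∃ x : X, ∃ ε : ℝ, 0 < ε ∧ U = {y : X | f (y - x) < ε}}

variable (p : ℕ) [Fact (Nat.Prime p)]
variable (k : Type) [Field k] [Algebra ℚ_[p] k] [FiniteDimensional ℚ_[p] k]

/-- The normalized absolute value on the local field k. -/
def absk (x : k) : ℝ := ‖(Algebra.norm ℚ_[p] x : ℚ_[p])‖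

/-- The topology of k as a local field. -/
def kTop : TopologicalSpace k := normTopology (absk p k)

variable (K : Type) [Field K] [Algebra k K] [CharZero K]
variable (Kn : ℕ → IntermediateField k K)

/-- The relative trace map between two intermediate fields. -/
def relTrace (E F : IntermediateField k K) (h : E ≤ F) (x : F) : E :=
  (@Algebra.trace E F _ _ (IntermediateField.inclusion h).toRingHom.toAlgebra) x

variable (T : ℕ → K →ₗ[k] K)

/-- The projective limit K̄ of the fields Kₙ along the normalized trace maps. -/
def ProjLim : Type :=
  {x : ℕ → K // (∀ n, x n ∈ Kn n) ∧ ∀ ⦃n ν : ℕ⦄, n ≤ ν → T n (x ν) = x n}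

/-- Pointwise addition on K̄. -/
def pladd (x y : ProjLim k K Kn T) : ProjLim k K Kn T :=
  ⟨fun n => x.1 n + y.1 n, by
    refine ⟨fun n => add_mem (x.2.1 n) (y.2.1 n), ?_⟩
    intro n ν h
    simp [map_add, x.2.2 h, y.2.2 h]⟩

/-- Pointwise scalar multiplication on K̄. -/
def plsmul (c : k) (x : ProjLim k K Kn T) : ProjLim k K Kn T :=
  ⟨fun n => c • x.1 n, by
    refine ⟨fun n => (Kn n).toSubalgebra.smul_mem (x.2.1 n) c, ?_⟩
    intro n ν h
    simp [_root_.map_smul, x.2.2 h]⟩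

/-- The topology on K̄ given by the seminorms x ↦ ‖xₙ‖. -/
def projTop (Knorm : K → ℝ) : TopologicalSpace (ProjLim k K Kn T) :=
  TopologicalSpace.generateFrom
    {U | ∃ x : ProjLim k K Kn T, ∃ n : ℕ, ∃ ε : ℝ, 0 < ε ∧
          U = {y : ProjLim k K Kn T | Knorm (y.1 n - x.1 n) < ε}}

/-- The Borel σ-algebra of the seminorm topology on K̄. -/
def projMeas (Knorm : K → ℝ) : MeasurableSpace (ProjLim k K Kn T) :=
  @borel _ (projTop k K Kn T Knorm)

/-- The topology on Kₙ induced from the absolute value ‖·‖. -/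
def KnTop (Knorm : K → ℝ) (n : ℕ) : TopologicalSpace (Kn n) :=
  TopologicalSpace.induced Subtype.val (normTopology Knorm)

/-- The Borel σ-algebra of Kₙ. -/
def KnMeas (Knorm : K → ℝ) (n : ℕ) : MeasurableSpace (Kn n) :=
  @borel _ (KnTop k K Kn Knorm n)

/-- The canonical embedding of K into K̄. -/
def emb (hTmem : ∀ n x, T n x ∈ Kn n)
    (hTproj : ∀ ⦃n ν : ℕ⦄, n ≤ ν → ∀ x : K, T n (T ν x) = T n x) (x : K) :
    ProjLim k K Kn T :=
  ⟨fun n => T n x, fun n => hTmem n x, fun n ν h => hTproj h x⟩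

/-- The weak topology σ(K̄, K) on K̄. -/
def weakTop (pairing : K → ProjLim k K Kn T → k) : TopologicalSpace (ProjLim k K Kn T) :=
  ⨅ a : K, TopologicalSpace.induced (pairing a) (kTop p k)

/-- Non-archimedean seminorms on K over k. -/
def IsNASeminorm (f : K → ℝ) : Prop :=
  (∀ x, 0 ≤ f x) ∧ (∀ x y, f (x + y) ≤ max (f x) (f y)) ∧
    ∀ (c : k) (x : K), f (c • x) = absk p k c * f x

/-- The locally convex topology determined by a family of seminorms. -/
def seminormFamilyTop (F : Set (K → ℝ)) : TopologicalSpace K :=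
  TopologicalSpace.generateFrom
    {U | ∃ f ∈ F, ∃ x : K, ∃ ε : ℝ, 0 < ε ∧ U = {y : K | f (y - x) < ε}}

/-- The inductive limit topology on K: the finest locally convex topology over k
making all the inclusions Kₙ → K continuous. -/
def indTop (Knorm : K → ℝ) : TopologicalSpace K :=
  sInf {t : TopologicalSpace K |
    (∃ F : Set (K → ℝ), (∀ f ∈ F, IsNASeminorm p k K f) ∧ t = seminormFamilyTop K F) ∧
    ∀ n : ℕ, @Continuous _ _ (KnTop k K Kn Knorm n) t Subtype.val}

/-- Locally constant functions with bounded (hence compact) support on Kₙ. -/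
def IsTestFun (Knorm : K → ℝ) (n : ℕ) (φ : Kn n → ℂ) : Prop :=
  @IsLocallyConstant _ _ (KnTop k K Kn Knorm n) φ ∧
    ∃ R : ℝ, ∀ ξ : Kn n, R < Knorm ↑ξ → φ ξ = 0


/-- The fractional differentiation operator Dᵅ applied to the cylindrical function φ ∘ Tₙ. -/
def Dop (Knorm : K → ℝ) (χ : k → ℂ) (pairing : K → ProjLim k K Kn T → k)
    (vol : ∀ n : ℕ, @MeasureTheory.Measure (Kn n) (KnMeas k K Kn Knorm n))
    (μ : @MeasureTheory.Measure (ProjLim k K Kn T) (projMeas k K Kn T Knorm))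
    (α : ℝ) (n : ℕ) (φ : Kn n → ℂ) (x : ProjLim k K Kn T) : ℂ :=
  ∫ ξ : Kn n,
    χ ((finrank k (Kn n) : k)⁻¹ *
        Algebra.trace k (Kn n) (-(⟨x.1 n, x.2.1 n⟩ * ξ))) *
      (if 1 < Knorm ↑ξ then ((Knorm ↑ξ ^ α : ℝ) : ℂ) else 0) *
      (∫ y, χ (pairing (↑ξ) y) * φ ⟨y.1 n, y.2.1 n⟩ ∂μ) ∂(vol n)
end

theorem absk_eq_spectralNorm_pow (p : ℕ) [Fact (Nat.Prime p)]
    (L : Type) [Field L] [Algebra ℚ_[p] L] [FiniteDimensional ℚ_[p] L] (x : L) :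
    absk p L x = spectralNorm ℚ_[p] L x ^ finrank ℚ_[p] L := by
  have hxi : IsIntegral ℚ_[p] x := Algebra.IsIntegral.isIntegral x
  have hd : (minpoly ℚ_[p] x).natDegree ≠ 0 := (minpoly.natDegree_pos hxi).ne'
  have hs : spectralNorm ℚ_[p] L x ^ (minpoly ℚ_[p] x).natDegree =
      ‖(minpoly ℚ_[p] x).coeff 0‖ := by
    rw [spectralNorm.spectralNorm_eq_norm_coeff_zero_rpow, one_div,
      Real.rpow_inv_natCast_pow (norm_nonneg _) hd]
  rw [absk, Algebra.norm_eq_norm_adjoin, ← IntermediateField.adjoin.powerBasis_gen hxi,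
    Algebra.PowerBasis.norm_gen_eq_coeff_zero_minpoly, IntermediateField.adjoin.powerBasis_gen,
    IntermediateField.minpoly_gen, norm_pow, norm_mul, norm_pow, norm_neg, norm_one, one_pow,
    one_mul, ← hs, ← pow_mul, ← IntermediateField.adjoin.finrank hxi,
    Module.finrank_mul_finrank]

section Normed

variable {p : ℕ} [Fact (Nat.Prime p)] {k : Type} [NormedField k] [NormedAlgebra ℚ_[p] k]
  [FiniteDimensional ℚ_[p] k]

theorem absk_eq_norm_pow (x : k) : absk p k x = ‖x‖ ^ finrank ℚ_[p] k := by
  rw [absk_eq_spectralNorm_pow, ← NormedAlgebra.norm_eq_spectralNorm]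

theorem absk_lt_pow_iff {x : k} {r : ℝ} (hr : 0 ≤ r) :
    absk p k x < r ^ finrank ℚ_[p] k ↔ ‖x‖ < r := by
  rw [absk_eq_norm_pow, pow_lt_pow_iff_left₀ (norm_nonneg x) hr finrank_pos.ne']

theorem absk_le_pow_iff {x : k} {r : ℝ} (hr : 0 ≤ r) :
    absk p k x ≤ r ^ finrank ℚ_[p] k ↔ ‖x‖ ≤ r := by
  rw [absk_eq_norm_pow, pow_le_pow_iff_left₀ (norm_nonneg x) hr finrank_pos.ne']

theorem exists_pow_finrank_eq (p : ℕ) [Fact (Nat.Prime p)] (k : Type) [Field k] [Algebra ℚ_[p] k]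
    [FiniteDimensional ℚ_[p] k] {ε : ℝ} (hε : 0 < ε) :
    ∃ r : ℝ, 0 < r ∧ r ^ finrank ℚ_[p] k = ε :=
  ⟨ε ^ ((finrank ℚ_[p] k : ℝ)⁻¹), by positivity,
    Real.rpow_inv_natCast_pow hε.le finrank_pos.ne'⟩

theorem kTop_eq : kTop p k = (inferInstance : TopologicalSpace k) := by
  refine le_antisymm ?_ (le_generateFrom ?_)
  · intro U hU
    rw [Metric.isOpen_iff] at hU
    let := kTop p k
    rw [isOpen_iff_forall_mem_open]
    intro x hx
    obtain ⟨ε, hε, h⟩ := hU x hx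
    refine ⟨Metric.ball x ε, h, ?_, Metric.mem_ball_self hε⟩
    refine TopologicalSpace.isOpen_generateFrom_of_mem
      ⟨x, ε ^ finrank ℚ_[p] k, by positivity, ?_⟩
    ext y
    rw [Set.mem_ofPred_eq, absk_lt_pow_iff hε.le, mem_ball_iff_norm]
  · rintro U ⟨x, ε, hε, rfl⟩
    obtain ⟨r, hr, rfl⟩ := exists_pow_finrank_eq p k hε
    convert Metric.isOpen_ball (x := x) (ε := r) using 1
    ext y
    rw [Set.mem_ofPred_eq, absk_lt_pow_iff hr.le, mem_ball_iff_norm]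

end Normed

theorem absk_mul {p : ℕ} [Fact (Nat.Prime p)] {k : Type} [Field k] [Algebra ℚ_[p] k] (x y : k) :
    absk p k (x * y) = absk p k x * absk p k y := by
  simp [absk]

section Fourier

open BoundedContinuousFunction

/-- Finite measures on a normed field are determined by their Fourier transform. -/
theorem ext_of_integral_addChar_eq {k : Type*} [NormedField k] [CompleteSpace k]
    [SecondCountableTopology k] [MeasurableSpace k] [BorelSpace k] {χ : k → ℂ}
    (hadd : ∀ x y, χ (x + y) = χ x * χ y) (hnorm : ∀ x, ‖χ x‖ = 1) (hcont : Continuous χ)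
    (hne : ∃ x, χ x ≠ 1) {μ ν : Measure k} [IsFiniteMeasure μ] [IsFiniteMeasure ν]
    (h : ∀ c, ∫ z, χ (c * z) ∂μ = ∫ z, χ (c * z) ∂ν) : μ = ν := by
  have h0 : χ 0 = 1 := by
    have h1 : χ 0 * χ 0 = χ 0 := by rw [← hadd, add_zero]
    have h2 : χ 0 ≠ 0 := by rw [← norm_ne_zero_iff, hnorm]; exact one_ne_zero
    exact mul_right_cancel₀ h2 (h1.trans (one_mul _).symm)
  have hneg (x : k) : χ (-x) = star (χ x) := by
    have h1 : χ (-x) * χ x = 1 := by rw [← hadd, neg_add_cancel, h0]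
    have h2 : star (χ x) * χ x = 1 := by
      simpa [hnorm] using Complex.conj_mul' (χ x)
    have h3 : χ x ≠ 0 := by rw [← norm_ne_zero_iff, hnorm]; exact one_ne_zero
    exact mul_right_cancel₀ h3 (h1.trans h2.symm)
  let φ (c : k) : k →ᵇ ℂ := BoundedContinuousFunction.ofNormedAddCommGroup (fun z ↦ χ (c * z))
    (hcont.comp (continuous_const_mul c)) 1 (fun z ↦ (hnorm _).le)
  have hφ (c z : k) : φ c z = χ (c * z) := rfl
  let Φ : Multiplicative k →* (k →ᵇ ℂ) :=
    { toFun := fun c ↦ φ c.toAdd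
      map_one' := by ext z; simp [hφ, h0]
      map_mul' := fun a b ↦ by ext z; simp [hφ, add_mul, hadd] }
  have hspan : ∀ g ∈ Submodule.span ℂ (Set.range φ), star g ∈ Submodule.span ℂ (Set.range φ) := by
    intro g hg
    induction hg using Submodule.span_induction with
    | mem x hx =>
      obtain ⟨c, rfl⟩ := hx
      refine Submodule.subset_span ⟨-c, ?_⟩
      ext z
      simp [hφ, hneg]
    | zero => simp
    | add x y _ _ hx hy => rw [star_add]; exact add_mem hx hy
    | smul a x _ hx => rw [star_smul]; exact Submodule.smul_mem _ _ hx
  have hadj : ∀ g, g ∈ Algebra.adjoin ℂ (Set.range φ) ↔ g ∈ Submodule.span ℂ (Set.range φ) := by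
    intro g
    have : (Submonoid.closure (Set.range φ) : Set (k →ᵇ ℂ)) = Set.range φ := by
      have h1 : Set.range φ = (MonoidHom.mrange Φ : Set (k →ᵇ ℂ)) := by
        ext g; simp [Φ, Multiplicative.exists]
      rw [h1, Submonoid.closure_eq]
    rw [← Subalgebra.mem_toSubmodule, Algebra.adjoin_eq_span, this]
  let A : StarSubalgebra ℂ (k →ᵇ ℂ) :=
    { Algebra.adjoin ℂ (Set.range φ) with
      star_mem' := fun {g} hg ↦ (hadj _).2 (hspan g ((hadj g).1 hg)) }
  have hA (g : k →ᵇ ℂ) : g ∈ A ↔ g ∈ Submodule.span ℂ (Set.range φ) := hadj g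
  refine ext_of_forall_mem_subalgebra_integral_eq_of_pseudoEMetric_complete_countable
    (A := A) (𝕜 := ℂ) ?_ ?_
  · intro x y hxy
    obtain ⟨w, hw⟩ := hne
    refine ⟨φ (w / (x - y)), ?_, ?_⟩
    · exact ⟨_, ⟨φ (w / (x - y)), (hA _).2 (Submodule.subset_span ⟨_, rfl⟩), rfl⟩, rfl⟩
    · rw [hφ, hφ]
      intro heq
      refine hw ?_
      have h1 : w = w / (x - y) * x + -(w / (x - y) * y) := by
        field_simp [sub_ne_zero.2 hxy]
        ring
      rw [h1, hadd, heq, ← hadd, add_neg_cancel, h0]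
  · intro g hg
    rw [hA] at hg
    induction hg using Submodule.span_induction with
    | mem x hx => obtain ⟨c, rfl⟩ := hx; exact h c
    | zero => simp
    | add x y _ _ hx hy =>
      simp only [BoundedContinuousFunction.coe_add, Pi.add_apply]
      rw [integral_add (x.integrable μ) (y.integrable μ),
        integral_add (x.integrable ν) (y.integrable ν), hx, hy]
    | smul a x _ hx =>
      simp only [BoundedContinuousFunction.coe_smul, integral_smul, hx]

end Fourier

theorem ENNReal.toReal_zpow (x : ENNReal) (n : ℤ) : (x ^ n).toReal = x.toReal ^ n := by
  cases n <;> simp [zpow_negSucc, ENNReal.toReal_inv, ENNReal.toReal_pow]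

section Haar

open scoped Pointwise

variable {p : ℕ} [Fact (Nat.Prime p)] {k : Type} [NormedField k] [NormedAlgebra ℚ_[p] k]
  [FiniteDimensional ℚ_[p] k]

theorem absk_natCast_prime (p : ℕ) [Fact (Nat.Prime p)] (k : Type) [Field k] [Algebra ℚ_[p] k]
    [FiniteDimensional ℚ_[p] k] : absk p k (p : k) = ((p : ℝ) ^ finrank ℚ_[p] k)⁻¹ := by
  rw [absk, ← map_natCast (algebraMap ℚ_[p] k), Algebra.norm_algebraMap, norm_pow, Padic.norm_p,
    inv_pow]

theorem Padic.norm_le_inv_iff_norm_lt_one (x : ℚ_[p]) : ‖x‖ ≤ (p : ℝ)⁻¹ ↔ ‖x‖ < 1 := by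
  simpa using Padic.norm_le_pow_iff_norm_lt_pow_add_one x (-1)

theorem Padic.existsUnique_fin_norm_sub_lt_one {x : ℚ_[p]} (hx : ‖x‖ ≤ 1) :
    ∃! n : Fin p, ‖x - (n : ℕ)‖ < 1 := by
  obtain ⟨y, rfl⟩ : ∃ y : ℤ_[p], (y : ℚ_[p]) = x := ⟨⟨x, hx⟩, rfl⟩
  obtain ⟨n, ⟨hn, hn1⟩, huniq⟩ := PadicInt.existsUnique_mem_range y
  have key (m : ℕ) : y - m ∈ IsLocalRing.maximalIdeal ℤ_[p] ↔
      ‖(y : ℚ_[p]) - (m : ℕ)‖ < 1 := by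
    rw [IsLocalRing.mem_maximalIdeal, PadicInt.mem_nonunits, PadicInt.norm_def]
    simp
  exact ⟨⟨n, hn⟩, (key n).1 hn1, fun m hm ↦ Fin.ext (huniq m ⟨m.2, (key m).2 hm⟩)⟩

theorem distribHaarChar_natCast_prime [LocallyCompactSpace k] (u : kˣ) (hu : (u : k) = p) :
    (distribHaarChar k u : ℝ) = absk p k u := by
  borelize k
  have hproper : ProperSpace k := FiniteDimensional.proper ℚ_[p] k
  set d := finrank ℚ_[p] k with hd
  let μ : Measure k := Measure.addHaar
  let g : k ≃ₗ[ℚ_[p]] (Fin d → ℚ_[p]) := (finBasis ℚ_[p] k).equivFun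
  have hg : Continuous g := LinearMap.continuous_of_finiteDimensional g.toLinearMap
  have hg' : Continuous g.symm := LinearMap.continuous_of_finiteDimensional g.symm.toLinearMap
  let S : Set k := {x | ∀ i, ‖g x i‖ ≤ 1}
  let S' : Set k := {x | ∀ i, ‖g x i‖ < 1}
  have hSpre : S = g ⁻¹' Set.pi Set.univ (fun _ ↦ Metric.closedBall 0 1) := by
    ext x; simp [S]
  have hScompact : IsCompact S := by
    have h1 : IsCompact (Set.pi Set.univ (fun _ : Fin d ↦ Metric.closedBall (0 : ℚ_[p]) 1)) :=
      isCompact_univ_pi fun _ ↦ isCompact_closedBall _ _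
    have h2 : S = g.symm '' Set.pi Set.univ (fun _ ↦ Metric.closedBall 0 1) := by
      rw [hSpre]
      exact (g.symm.toEquiv.image_eq_preimage_symm _).symm
    rw [h2]
    exact h1.image hg'
  have hS'open : IsOpen S' := by
    have h1 : S' = g ⁻¹' Set.pi Set.univ (fun _ ↦ Metric.ball 0 1) := by
      ext x; simp [S']
    rw [h1]
    exact (isOpen_set_pi Set.finite_univ fun _ _ ↦ Metric.isOpen_ball).preimage hg
  have hS'S : S' ⊆ S := fun x hx i ↦ (hx i).le
  have hSpos : μ S ≠ 0 := by
    have h1 : 0 < μ S' := hS'open.measure_pos μ ⟨0, fun i ↦ by simp⟩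
    exact (h1.trans_le (measure_mono hS'S)).ne'
  have hpS : u • S = S' := by
    ext x
    rw [Set.mem_smul_set_iff_inv_smul_mem]
    refine forall_congr' fun i ↦ ?_
    have h1 : g (u⁻¹ • x) = (p : ℚ_[p])⁻¹ • g x := by
      have h2 : u⁻¹ • x = (p : ℚ_[p])⁻¹ • x := by
        rw [Units.smul_def, Units.val_inv_eq_inv_val, hu, smul_eq_mul, Algebra.smul_def,
          map_inv₀, map_natCast]
      rw [h2, map_smul]
    have hp : (0 : ℝ) < p := by exact_mod_cast (Fact.out : p.Prime).pos
    rw [h1, Pi.smul_apply, smul_eq_mul, norm_mul, norm_inv, Padic.norm_p, inv_inv,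
      ← Padic.norm_le_inv_iff_norm_lt_one, ← one_div, le_div_iff₀' hp]
  have hunion : S = ⋃ r : Fin d → Fin p,
      (fun x ↦ -(g.symm fun i ↦ ((r i : ℕ) : ℚ_[p])) + x) ⁻¹' S' := by
    ext x
    simp only [Set.mem_iUnion, Set.mem_preimage]
    have key (r : Fin d → Fin p) : -(g.symm fun i ↦ ((r i : ℕ) : ℚ_[p])) + x ∈ S' ↔
        ∀ i, ‖g x i - ((r i : ℕ) : ℚ_[p])‖ < 1 := by
      refine forall_congr' fun i ↦ ?_
      rw [map_add, map_neg, g.apply_symm_apply, neg_add_eq_sub, Pi.sub_apply]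
    simp only [key]
    constructor
    · intro hx
      choose r hr using fun i ↦ (Padic.existsUnique_fin_norm_sub_lt_one (hx i)).exists
      exact ⟨r, hr⟩
    · rintro ⟨r, hr⟩ i
      have h1 := Padic.nonarchimedean (g x i - ((r i : ℕ) : ℚ_[p])) ((r i : ℕ) : ℚ_[p])
      rw [sub_add_cancel] at h1
      exact h1.trans (max_le (hr i).le (by simpa using Padic.norm_int_le_one (p := p) (r i : ℕ)))
  have hdisj : Pairwise (Function.onFun Disjoint fun r : Fin d → Fin p ↦
      (fun x ↦ -(g.symm fun i ↦ ((r i : ℕ) : ℚ_[p])) + x) ⁻¹' S') := by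
    intro r s hrs
    refine Set.disjoint_left.2 fun x hx hy ↦ hrs ?_
    have hxS : x ∈ S := hunion ▸ Set.mem_iUnion.2 ⟨r, hx⟩
    funext i
    have h1 := hx i
    have h2 := hy i
    rw [map_add, map_neg, g.apply_symm_apply, neg_add_eq_sub, Pi.sub_apply] at h1 h2
    exact (Padic.existsUnique_fin_norm_sub_lt_one (hxS i)).unique h1 h2
  have hmeas : μ S = (p : ENNReal) ^ d * μ S' := by
    conv_lhs => rw [hunion]
    rw [measure_iUnion hdisj fun r ↦ (hS'open.measurableSet.preimage (measurable_const_add _))]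
    simp [measure_preimage_add]
  have h1 : distribHaarChar k u = ((p : NNReal) ^ d)⁻¹ := by
    refine distribHaarChar_eq_of_measure_smul_eq_mul (μ := μ) hSpos hScompact.measure_ne_top ?_
    have hp0 : (p : NNReal) ^ d ≠ 0 := by
      simp [(Fact.out : p.Prime).ne_zero]
    rw [hpS, hmeas, ENNReal.coe_inv hp0, ← mul_assoc, ENNReal.coe_pow, ENNReal.coe_natCast,
      ENNReal.inv_mul_cancel, one_mul]
    · exact pow_ne_zero _ (by simp [(Fact.out : p.Prime).ne_zero])
    · exact ENNReal.pow_ne_top (by simp)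
  rw [h1, hu, absk_natCast_prime]
  simp [hd]

variable {Q : ℝ}

theorem one_lt_of_isGreatest
    (hQ : IsGreatest {r : ℝ | (∃ x : k, absk p k x = r) ∧ r < 1} Q⁻¹) : 1 < Q := by
  have hp : 1 < (p : ℝ) := by exact_mod_cast (Fact.out : p.Prime).one_lt
  have hd : finrank ℚ_[p] k ≠ 0 := finrank_pos.ne'
  have h1 : ((p : ℝ) ^ finrank ℚ_[p] k)⁻¹ ≤ Q⁻¹ :=
    hQ.2 ⟨⟨p, absk_natCast_prime p k⟩, inv_lt_one_of_one_lt₀ (one_lt_pow₀ hp hd)⟩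
  have h2 : 0 < Q := inv_pos.1 (lt_of_lt_of_le (by positivity) h1)
  exact (inv_lt_one₀ h2).1 hQ.1.2

theorem exists_absk_eq_zpow
    (hQ : IsGreatest {r : ℝ | (∃ x : k, absk p k x = r) ∧ r < 1} Q⁻¹) {x : k} (hx : x ≠ 0) :
    ∃ n : ℤ, absk p k x = Q ^ n := by
  have hQ1 := one_lt_of_isGreatest hQ
  have hQ0 : 0 < Q := one_pos.trans hQ1
  obtain ⟨ϖ, hϖ⟩ := hQ.1.1
  have hpos : 0 < absk p k x := by
    rw [absk_eq_norm_pow]; exact pow_pos (norm_pos_iff.2 hx) _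
  obtain ⟨n, hn, hn'⟩ := exists_mem_Ico_zpow hpos hQ1
  refine ⟨n, le_antisymm ?_ hn⟩
  have hϖn : absk p k (x * ϖ ^ (n + 1)) = absk p k x * (Q ^ (n + 1))⁻¹ := by
    rw [absk_mul, absk_eq_norm_pow (ϖ ^ (n + 1)), norm_zpow, ← zpow_natCast, zpow_comm, zpow_natCast,
      ← absk_eq_norm_pow, hϖ, inv_zpow]
  have h2 : absk p k x * (Q ^ (n + 1))⁻¹ ≤ Q⁻¹ := by
    refine hQ.2 ⟨⟨_, hϖn⟩, ?_⟩
    rw [← div_eq_mul_inv, div_lt_one (zpow_pos hQ0 _)]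
    exact hn'
  rw [← div_eq_mul_inv, div_le_iff₀ (zpow_pos hQ0 _), zpow_add₀ hQ0.ne', zpow_one] at h2
  calc absk p k x ≤ Q⁻¹ * (Q ^ n * Q) := h2
    _ = Q ^ n := by field_simp

theorem exists_absk_eq_zpow'
    (hQ : IsGreatest {r : ℝ | (∃ x : k, absk p k x = r) ∧ r < 1} Q⁻¹) (n : ℤ) :
    ∃ u : kˣ, absk p k u = Q ^ n := by
  have hQ1 := one_lt_of_isGreatest hQ
  obtain ⟨ϖ, hϖ⟩ := hQ.1.1
  have hϖ0 : ϖ ≠ 0 := by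
    rintro rfl
    rw [absk_eq_norm_pow, norm_zero, zero_pow finrank_pos.ne'] at hϖ
    exact (inv_pos.2 (one_pos.trans hQ1)).ne hϖ
  refine ⟨Units.mk0 ϖ hϖ0 ^ (-n), ?_⟩
  rw [absk_eq_norm_pow, Units.val_zpow_eq_zpow_val, Units.val_mk0, norm_zpow, ← zpow_natCast,
    zpow_comm, zpow_natCast, ← absk_eq_norm_pow, hϖ, inv_zpow, zpow_neg, inv_inv]

/-- The module of a local field is its normalized absolute value. -/
theorem distribHaarChar_eq_absk [LocallyCompactSpace k]
    (hQ : IsGreatest {r : ℝ | (∃ x : k, absk p k x = r) ∧ r < 1} Q⁻¹) (u : kˣ) :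
    (distribHaarChar k u : ℝ) = absk p k u := by
  have hproper : ProperSpace k := FiniteDimensional.proper ℚ_[p] k
  have hQ1 := one_lt_of_isGreatest hQ
  have hQ0 : 0 < Q := one_pos.trans hQ1
  have habs (v : kˣ) (n : ℤ) : absk p k ((v ^ n : kˣ) : k) = absk p k v ^ n := by
    rw [absk_eq_norm_pow, Units.val_zpow_eq_zpow_val, norm_zpow, ← zpow_natCast,
      zpow_comm, zpow_natCast, ← absk_eq_norm_pow]
  have hone (v : kˣ) (hv : absk p k v = 1) : distribHaarChar k v = 1 := by
    borelize k
    refine distribHaarChar_eq_of_measure_smul_eq_mul (μ := Measure.addHaar)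
      (s := Metric.closedBall 0 1) ?_ (isCompact_closedBall _ _).measure_ne_top ?_
    · exact (Metric.measure_closedBall_pos _ _ one_pos).ne'
    · have hv1 : ‖(v : k)‖ = 1 := by
        rw [absk_eq_norm_pow] at hv
        exact (pow_eq_one_iff_of_nonneg (norm_nonneg _) finrank_pos.ne').1 hv
      rw [ENNReal.coe_one, one_mul]
      congr 1
      ext x
      rw [Set.mem_smul_set_iff_inv_smul_mem]
      simp [Units.smul_def, hv1]
  obtain ⟨ϖ, hϖ⟩ := exists_absk_eq_zpow' hQ 1
  rw [zpow_one] at hϖ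
  have hfac (v : kˣ) (n : ℤ) (hv : absk p k v = Q ^ n) :
      distribHaarChar k v = distribHaarChar k ϖ ^ n := by
    have h1 : distribHaarChar k (v * ϖ ^ (-n)) = 1 := by
      refine hone _ ?_
      rw [Units.val_mul, absk_mul, hv, habs, hϖ, ← zpow_add₀ hQ0.ne', add_neg_cancel, zpow_zero]
    rw [map_mul, map_zpow, zpow_neg] at h1
    exact eq_of_mul_inv_eq_one h1
  have hp0 : (p : k) ≠ 0 := by
    rw [← map_natCast (algebraMap ℚ_[p] k), map_ne_zero]
    exact_mod_cast (Fact.out : p.Prime).ne_zero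
  obtain ⟨n, hn⟩ := exists_absk_eq_zpow hQ hp0
  have hn0 : n ≠ 0 := by
    rintro rfl
    have hp : 1 < (p : ℝ) := by exact_mod_cast (Fact.out : p.Prime).one_lt
    rw [absk_natCast_prime, zpow_zero, inv_eq_one] at hn
    exact (one_lt_pow₀ hp finrank_pos.ne').ne' hn
  have hϖQ : (distribHaarChar k ϖ : ℝ) = Q := by
    have h1 := distribHaarChar_natCast_prime (p := p) (Units.mk0 (p : k) hp0) rfl
    rw [Units.val_mk0, hn, hfac _ n hn, NNReal.coe_zpow] at h1
    exact (zpow_left_inj₀ (NNReal.coe_nonneg _) hQ0.le hn0).1 h1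
  obtain ⟨m, hm⟩ := exists_absk_eq_zpow hQ u.ne_zero
  rw [hfac u m hm, NNReal.coe_zpow, hϖQ, hm]

theorem measure_absk_le_zpow [MeasurableSpace k] [BorelSpace k]
    (hQ : IsGreatest {r : ℝ | (∃ x : k, absk p k x = r) ∧ r < 1} Q⁻¹)
    (μ : Measure k) [μ.IsAddHaarMeasure] (h1 : μ {z | absk p k z ≤ 1} = 1) (n : ℤ) :
    μ {z | absk p k z ≤ Q ^ n} = ENNReal.ofReal Q ^ n := by
  have hproper : ProperSpace k := FiniteDimensional.proper ℚ_[p] k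
  have hQ0 : 0 < Q := one_pos.trans (one_lt_of_isGreatest hQ)
  obtain ⟨u, hu⟩ := exists_absk_eq_zpow' hQ n
  have hset : {z | absk p k z ≤ Q ^ n} = u • {z : k | absk p k z ≤ 1} := by
    ext x
    have h2 : absk p k x = absk p k u * absk p k (u⁻¹ • x) := by
      rw [← absk_mul, Units.smul_def, smul_eq_mul, Units.mul_inv_cancel_left]
    rw [Set.mem_smul_set_iff_inv_smul_mem, Set.mem_ofPred_eq, Set.mem_ofPred_eq, h2, hu,
      mul_le_iff_le_one_right (zpow_pos hQ0 n)]
  rw [hset, ← distribHaarChar_mul, h1, mul_one, ← ENNReal.ofReal_coe_nnreal,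
    distribHaarChar_eq_absk hQ, hu]
  cases n <;> simp [zpow_negSucc, ENNReal.ofReal_inv_of_pos, ENNReal.ofReal_pow, hQ0, hQ0.le]

theorem fourier_restrict_absk_le_zpow [MeasurableSpace k] [BorelSpace k]
    (hQ : IsGreatest {r : ℝ | (∃ x : k, absk p k x = r) ∧ r < 1} Q⁻¹)
    (μ : Measure k) [μ.IsAddHaarMeasure] (h1 : μ {z | absk p k z ≤ 1} = 1)
    {χ : k → ℂ} (hadd : ∀ x y, χ (x + y) = χ x * χ y)
    (htriv : ∀ x, absk p k x ≤ 1 → χ x = 1) (hrank : ∃ x, absk p k x ≤ Q ∧ χ x ≠ 1)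
    (m : ℤ) (c : k) :
    ∫ z in {z | absk p k z ≤ Q ^ (-m)}, χ (c * z) ∂μ =
      if absk p k c ≤ Q ^ m then ((Q ^ (-m) : ℝ) : ℂ) else 0 := by
  have hQ1 := one_lt_of_isGreatest hQ
  have hQ0 : 0 < Q := one_pos.trans hQ1
  have hclosed (t : ℝ) : IsClosed {z : k | absk p k z ≤ t} := by
    simp only [absk_eq_norm_pow]
    exact isClosed_le (by fun_prop) continuous_const
  split_ifs with hc
  · have h2 : ∀ z ∈ {z | absk p k z ≤ Q ^ (-m)}, χ (c * z) = 1 := fun z hz ↦ by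
      refine htriv _ ?_
      calc absk p k (c * z) = absk p k c * absk p k z := absk_mul c z
        _ ≤ Q ^ m * Q ^ (-m) := mul_le_mul hc hz (norm_nonneg _) (zpow_pos hQ0 _).le
        _ = 1 := by rw [← zpow_add₀ hQ0.ne', add_neg_cancel, zpow_zero]
    rw [setIntegral_congr_fun (hclosed _).measurableSet h2, setIntegral_const, measureReal_def,
      measure_absk_le_zpow hQ μ h1]
    simp [ENNReal.toReal_ofReal hQ0.le, ENNReal.toReal_zpow]
  · rw [not_le] at hc
    have hc0 : c ≠ 0 := by
      rintro rfl
      rw [absk_eq_norm_pow, norm_zero, zero_pow finrank_pos.ne'] at hc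
      exact (zpow_pos hQ0 m).not_gt hc
    obtain ⟨n, hn⟩ := exists_absk_eq_zpow hQ hc0
    rw [hn, zpow_lt_zpow_iff_right₀ hQ1] at hc
    obtain ⟨y, hy, hy1⟩ := hrank
    obtain ⟨w, rfl⟩ : ∃ w, c * w = y := ⟨y / c, mul_div_cancel₀ y hc0⟩
    have hw : absk p k w ≤ Q ^ (-m) := by
      rw [absk_mul, hn, ← le_div_iff₀' (zpow_pos hQ0 n)] at hy
      have h2 : Q / Q ^ n = Q ^ (1 - n) := by rw [zpow_sub₀ hQ0.ne', zpow_one]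
      rw [h2] at hy
      exact hy.trans (zpow_le_zpow_right₀ hQ1.le (by lia))
    have hinv (z : k) : absk p k (z + w) ≤ Q ^ (-m) ↔ absk p k z ≤ Q ^ (-m) := by
      obtain ⟨r, hr, hr'⟩ := exists_pow_finrank_eq p k (zpow_pos hQ0 (-m))
      rw [← hr'] at hw ⊢
      have hna : IsNonarchimedean (norm : k → ℝ) := by
        have : (norm : k → ℝ) = spectralNorm ℚ_[p] k :=
          funext (NormedAlgebra.norm_eq_spectralNorm ℚ_[p])
        rw [this]
        exact isNonarchimedean_spectralNorm
      rw [absk_le_pow_iff hr.le] at hw ⊢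
      rw [absk_le_pow_iff hr.le]
      refine ⟨fun h ↦ ?_, fun h ↦ (hna z w).trans (max_le h hw)⟩
      have h3 := hna (z + w) (-w)
      rw [add_neg_cancel_right, norm_neg] at h3
      exact h3.trans (max_le h hw)
    have key : ∫ z in {z | absk p k z ≤ Q ^ (-m)}, χ (c * z) ∂μ =
        (∫ z in {z | absk p k z ≤ Q ^ (-m)}, χ (c * z) ∂μ) * χ (c * w) := by
      rw [← integral_indicator (hclosed _).measurableSet, ← integral_mul_const]
      conv_lhs => rw [← integral_add_right_eq_self _ w]
      congr 1
      ext z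
      simp only [Set.indicator_apply, Set.mem_ofPred_eq, hinv]
      split_ifs
      · rw [mul_add, hadd]
      · rw [zero_mul]
    by_contra h0
    exact hy1 (mul_left_cancel₀ h0 (key.symm.trans (mul_one _).symm))

theorem eq_smul_restrict_of_fourier [MeasurableSpace k] [BorelSpace k] {q : ℕ}
    (hQ : IsGreatest {r : ℝ | (∃ x : k, absk p k x = r) ∧ r < 1} (q : ℝ)⁻¹)
    (μ : Measure k) (hinv : ∀ (a : k) (A : Set k), MeasurableSet A →
      μ ((fun z ↦ a + z) ⁻¹' A) = μ A) (h1 : μ {z | absk p k z ≤ 1} = 1)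
    {χ : k → ℂ} (hadd : ∀ x y, χ (x + y) = χ x * χ y) (hnorm : ∀ x, ‖χ x‖ = 1)
    (hcont : Continuous χ)
    (htriv : ∀ x, absk p k x ≤ 1 → χ x = 1) (hrank : ∃ x, absk p k x ≤ q ∧ χ x ≠ 1)
    (ν : Measure k) [IsFiniteMeasure ν] (m : ℤ)
    (hν : ∀ c, ∫ z, χ (c * z) ∂ν = if absk p k c ≤ (q : ℝ) ^ m then 1 else 0) :
    ν = (q : ENNReal) ^ m • μ.restrict {z | absk p k z ≤ (q : ℝ) ^ (-m)} := by
  have hproper : ProperSpace k := FiniteDimensional.proper ℚ_[p] k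
  have hQ0 : 0 < (q : ℝ) := one_pos.trans (one_lt_of_isGreatest hQ)
  have hq0 : (q : ENNReal) ≠ 0 := by exact_mod_cast hQ0.ne'
  have hleft : μ.IsAddLeftInvariant :=
    ⟨fun a ↦ Measure.ext fun A hA ↦ by
      rw [Measure.map_apply (measurable_const_add a) hA, hinv a A hA]⟩
  have hball : {z : k | absk p k z ≤ 1} = Metric.closedBall 0 1 := by
    ext z
    have h2 := absk_le_pow_iff (p := p) (x := z) zero_le_one
    rw [one_pow] at h2
    simp [h2]
  have hhaar : μ.IsAddHaarMeasure := by
    rw [hball] at h1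
    exact Measure.isAddHaarMeasure_of_isCompact_nonempty_interior μ (Metric.closedBall 0 1)
      (isCompact_closedBall _ _)
      ⟨0, Metric.ball_subset_interior_closedBall (Metric.mem_ball_self one_pos)⟩
      (by simp [h1]) (by simp [h1])
  have hmass : μ {z | absk p k z ≤ (q : ℝ) ^ (-m)} = (q : ENNReal) ^ (-m) := by
    rw [measure_absk_le_zpow hQ μ h1, ENNReal.ofReal_natCast]
  have hfin : IsFiniteMeasure
      ((q : ENNReal) ^ m • μ.restrict {z | absk p k z ≤ (q : ℝ) ^ (-m)}) := by
    refine ⟨?_⟩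
    rw [Measure.smul_apply, Measure.restrict_apply_univ, hmass, smul_eq_mul,
      ← ENNReal.zpow_add hq0 (ENNReal.natCast_ne_top q), add_neg_cancel, zpow_zero]
    exact ENNReal.one_lt_top
  refine ext_of_integral_addChar_eq hadd hnorm hcont (hrank.imp fun x hx ↦ hx.2) fun c ↦ ?_
  rw [hν, integral_smul_measure, fourier_restrict_absk_le_zpow hQ μ h1 hadd htriv hrank]
  split_ifs
  · have hqC : (q : ℂ) ≠ 0 := by exact_mod_cast hQ0.ne'
    simp [ENNReal.toReal_zpow, zpow_ne_zero m hqC]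
  · simp

end Haar

section LocalField

variable {p : ℕ} [Fact (Nat.Prime p)]

theorem continuous_kTop_of_linearMap {E F : Type} [Field E] [Algebra ℚ_[p] E]
    [FiniteDimensional ℚ_[p] E] [Field F] [Algebra ℚ_[p] F] [FiniteDimensional ℚ_[p] F]
    (φ : E →ₗ[ℚ_[p]] F) : @Continuous E F (kTop p E) (kTop p F) φ := by
  let _ := spectralNorm.normedField ℚ_[p] E
  let _ := spectralNorm.normedAlgebra ℚ_[p] E
  let _ := spectralNorm.normedField ℚ_[p] F
  let _ := spectralNorm.normedAlgebra ℚ_[p] F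
  have hE : kTop p E = (inferInstance : TopologicalSpace E) := kTop_eq
  have hF : kTop p F = (inferInstance : TopologicalSpace F) := kTop_eq
  rw [hE, hF]
  exact LinearMap.continuous_of_finiteDimensional φ

theorem measure_eq_smul_restrict_of_fourier {k : Type} [Field k] [Algebra ℚ_[p] k]
    [FiniteDimensional ℚ_[p] k] {q : ℕ}
    (hQ : IsGreatest {r : ℝ | (∃ x : k, absk p k x = r) ∧ r < 1} (q : ℝ)⁻¹)
    (μ : @Measure k (@borel k (kTop p k)))
    (hinv : ∀ (a : k) (A : Set k), MeasurableSet[@borel k (kTop p k)] A →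
      μ ((fun z ↦ a + z) ⁻¹' A) = μ A) (h1 : μ {z | absk p k z ≤ 1} = 1)
    {χ : k → ℂ} (hadd : ∀ x y, χ (x + y) = χ x * χ y) (hnorm : ∀ x, ‖χ x‖ = 1)
    (hcont : @Continuous _ _ (kTop p k) _ χ)
    (htriv : ∀ x, absk p k x ≤ 1 → χ x = 1) (hrank : ∃ x, absk p k x ≤ q ∧ χ x ≠ 1)
    (ν : @Measure k (@borel k (kTop p k))) (hfin : IsFiniteMeasure ν) (m : ℤ)
    (hν : ∀ c, ∫ z, χ (c * z) ∂ν = if absk p k c ≤ (q : ℝ) ^ m then 1 else 0) :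
    ν = (q : ENNReal) ^ m • @Measure.restrict k (@borel k (kTop p k)) μ
      {z | absk p k z ≤ (q : ℝ) ^ (-m)} := by
  let _ := spectralNorm.normedField ℚ_[p] k
  let _ := spectralNorm.normedAlgebra ℚ_[p] k
  have hk : kTop p k = (inferInstance : TopologicalSpace k) := kTop_eq
  generalize kTop p k = t at *
  subst hk
  let _ : MeasurableSpace k := borel k
  have : BorelSpace k := ⟨rfl⟩
  exact eq_smul_restrict_of_fourier hQ μ hinv h1 hadd hnorm hcont htriv hrank ν m hν

theorem one_lt_and_exists_absk_eq_zpow {k : Type} [Field k] [Algebra ℚ_[p] k]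
    [FiniteDimensional ℚ_[p] k] {Q : ℝ}
    (hQ : IsGreatest {r : ℝ | (∃ x : k, absk p k x = r) ∧ r < 1} Q⁻¹) :
    1 < Q ∧ ∀ c : k, c ≠ 0 → ∃ v : ℤ, absk p k c = Q ^ v := by
  let _ := spectralNorm.normedField ℚ_[p] k
  let _ := spectralNorm.normedAlgebra ℚ_[p] k
  exact ⟨one_lt_of_isGreatest hQ, fun _ hc ↦ exists_absk_eq_zpow hQ hc⟩

variable {k : Type} [Field k] [Algebra ℚ_[p] k] [FiniteDimensional ℚ_[p] k]
  {K : Type} [Field K] [Algebra k K] {Kn : ℕ → IntermediateField k K} {T : ℕ → K →ₗ[k] K}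

theorem continuous_projLim_eval (Knorm : K → ℝ) (n : ℕ) [FiniteDimensional k (Kn n)]
    [Algebra ℚ_[p] (Kn n)] [IsScalarTower ℚ_[p] k (Kn n)] [FiniteDimensional ℚ_[p] (Kn n)]
    (hKnorm : ∀ (x : K) (hx : x ∈ Kn n),
      Knorm x = absk p k (Algebra.norm k (⟨x, hx⟩ : Kn n)) ^ ((finrank k (Kn n) : ℝ)⁻¹)) :
    @Continuous (ProjLim k K Kn T) (Kn n) (projTop k K Kn T Knorm) (kTop p (Kn n))
      (fun x ↦ ⟨x.1 n, x.2.1 n⟩) := by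
  let _ := spectralNorm.normedField ℚ_[p] (Kn n)
  let _ := spectralNorm.normedAlgebra ℚ_[p] (Kn n)
  have hE : kTop p (Kn n) = (inferInstance : TopologicalSpace (Kn n)) := kTop_eq
  rw [hE]
  let _ := projTop k K Kn T Knorm
  have hlt (z : K) (hz : z ∈ Kn n) {ε : ℝ} (hε : 0 < ε) :
      Knorm z < (ε ^ finrank ℚ_[p] (Kn n)) ^ ((finrank k (Kn n) : ℝ)⁻¹) ↔
        ‖(⟨z, hz⟩ : Kn n)‖ < ε := by
    have h0 : absk p k (Algebra.norm k (⟨z, hz⟩ : Kn n)) = absk p (Kn n) ⟨z, hz⟩ := by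
      rw [absk, absk, Algebra.norm_norm]
    have h1 : 0 ≤ absk p (Kn n) ⟨z, hz⟩ := norm_nonneg _
    have hM : (0 : ℝ) < finrank k (Kn n) := by exact_mod_cast finrank_pos
    rw [hKnorm z hz, h0, Real.rpow_lt_rpow_iff h1 (by positivity) (inv_pos.2 hM)]
    exact absk_lt_pow_iff hε.le
  rw [Metric.continuous_iff']
  intro x ε hε
  have hopen : IsOpen {y : ProjLim k K Kn T |
      Knorm (y.1 n - x.1 n) < (ε ^ finrank ℚ_[p] (Kn n)) ^ ((finrank k (Kn n) : ℝ)⁻¹)} :=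
    TopologicalSpace.isOpen_generateFrom_of_mem ⟨x, n, _, by positivity, rfl⟩
  have hmem (y : ProjLim k K Kn T) : y ∈ {y : ProjLim k K Kn T |
      Knorm (y.1 n - x.1 n) < (ε ^ finrank ℚ_[p] (Kn n)) ^ ((finrank k (Kn n) : ℝ)⁻¹)} ↔
      dist (⟨y.1 n, y.2.1 n⟩ : Kn n) ⟨x.1 n, x.2.1 n⟩ < ε := by
    rw [Set.mem_ofPred_eq, hlt _ (sub_mem (y.2.1 n) (x.2.1 n)) hε, dist_eq_norm]
    rfl
  filter_upwards [hopen.mem_nhds ((hmem x).2 (by rwa [dist_self]))] with y hy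
  exact (hmem y).1 hy

theorem continuous_pairing (Knorm : K → ℝ) (n : ℕ) [FiniteDimensional k (Kn n)]
    (hKnorm : ∀ (x : K) (hx : x ∈ Kn n),
      Knorm x = absk p k (Algebra.norm k (⟨x, hx⟩ : Kn n)) ^ ((finrank k (Kn n) : ℝ)⁻¹))
    (c : k) {a : K} (ha : a ∈ Kn n) :
    @Continuous (ProjLim k K Kn T) k (projTop k K Kn T Knorm) (kTop p k)
      (fun x ↦ c * Algebra.trace k (Kn n) (⟨a * x.1 n, mul_mem ha (x.2.1 n)⟩ : Kn n)) := by
  let _ : Algebra ℚ_[p] (Kn n) :=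
    ((algebraMap k (Kn n)).comp (algebraMap ℚ_[p] k)).toAlgebra
  have : IsScalarTower ℚ_[p] k (Kn n) := IsScalarTower.of_algebraMap_eq fun _ ↦ rfl
  have : FiniteDimensional ℚ_[p] (Kn n) := FiniteDimensional.trans ℚ_[p] k (Kn n)
  let φ : Kn n →ₗ[k] k :=
    c • (Algebra.trace k (Kn n) ∘ₗ LinearMap.mulLeft k (⟨a, ha⟩ : Kn n))
  exact @Continuous.comp _ _ _ (projTop k K Kn T Knorm) (kTop p (Kn n)) (kTop p k) _ _
    (continuous_kTop_of_linearMap (φ.restrictScalars ℚ_[p]))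
    (continuous_projLim_eval Knorm n hKnorm)

end LocalField

theorem statement_8
    (p : ℕ) [Fact (Nat.Prime p)]
    (k : Type) [Field k] [Algebra ℚ_[p] k] [FiniteDimensional ℚ_[p] k]
    (K : Type) [Field K] [Algebra k K] [CharZero K]
    (Kn : ℕ → IntermediateField k K)
    (hbot : Kn 1 = ⊥) (hmono : Monotone Kn)
    [hfd : ∀ n, FiniteDimensional k (Kn n)]
    (hunion : ∀ x : K, ∃ n, x ∈ Kn n)
    (T : ℕ → K →ₗ[k] K)
    (hTmem : ∀ (n : ℕ) (x : K), T n x ∈ Kn n)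
    (hTdef : ∀ (n ν : ℕ) (h : n ≤ ν) (x : K) (hx : x ∈ Kn ν),
      T n x = ((finrank k (Kn n) : K) / (finrank k (Kn ν) : K)) *
        (relTrace k K (Kn n) (Kn ν) (hmono h) ⟨x, hx⟩ : K))
    (Knorm : K → ℝ)
    (hKnorm : ∀ (n : ℕ) (x : K) (hx : x ∈ Kn n),
      Knorm x = absk p k (Algebra.norm k (⟨x, hx⟩ : Kn n)) ^ ((finrank k (Kn n) : ℝ)⁻¹))
    (pairing : K → ProjLim k K Kn T → k)
    (hpair : ∀ (n : ℕ) (a : K) (ha : a ∈ Kn n) (x : ProjLim k K Kn T),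
      pairing a x = (finrank k (Kn n) : k)⁻¹ *
        Algebra.trace k (Kn n) (⟨a * x.1 n, mul_mem ha (x.2.1 n)⟩ : Kn n))
    (q : ℕ → ℕ)
    (hq : ∀ n : ℕ, IsGreatest
      {r : ℝ | (∃ x : Kn n, Knorm ↑x ^ (finrank k (Kn n) : ℝ) = r) ∧ r < 1} ((q n : ℝ)⁻¹))
    (χ : k → ℂ)
    (hχadd : ∀ x y : k, χ (x + y) = χ x * χ y)
    (hχnorm : ∀ x : k, ‖χ x‖ = 1)
    (hχcont : @Continuous _ _ (kTop p k) _ χ)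
    (hχtriv : ∀ x : k, absk p k x ≤ 1 → χ x = 1)
    (hχrank : ∃ x : k, absk p k x ≤ (q 1 : ℝ) ∧ χ x ≠ 1)
    (μ : @MeasureTheory.Measure (ProjLim k K Kn T) (projMeas k K Kn T Knorm))
    (hμprob : MeasureTheory.IsProbabilityMeasure μ)
    (hμradon : ∀ A : Set (ProjLim k K Kn T), MeasurableSet[projMeas k K Kn T Knorm] A →
      μ A = ⨆ (C : Set (ProjLim k K Kn T))
        (_ : C ⊆ A ∧ @IsCompact _ (projTop k K Kn T Knorm) C), μ C)
    (hμchar : ∀ a : K, ∫ x, χ (pairing a x) ∂μ = if Knorm a ≤ 1 then (1 : ℂ) else 0)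
    (e f : ℕ → ℕ)
    (hef : ∀ n : ℕ, q n = q 1 ^ f n ∧ finrank k (Kn n) = e n * f n)
    (volk : @MeasureTheory.Measure k (@borel k (kTop p k)))
    (hvolkinv : ∀ (a : k) (A : Set k), MeasurableSet[@borel k (kTop p k)] A →
      volk ((fun z => a + z) ⁻¹' A) = volk A)
    (hvolknorm : volk {z : k | absk p k z ≤ 1} = 1)
    (n : ℕ) (hn : 1 ≤ n) (a : K) (ha : a ∈ Kn n) (ha0 : a ≠ 0) (N : ℤ)
    (hN : Knorm a ^ (finrank k (Kn n) : ℝ) = (q n : ℝ) ^ N) :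
    @MeasureTheory.Measure.map (ProjLim k K Kn T) k (projMeas k K Kn T Knorm)
        (@borel k (kTop p k)) (fun x => pairing a x) μ =
      ((q 1 : ENNReal) ^ ⌊(-(N : ℝ)) / (e n : ℝ)⌋) •
        @MeasureTheory.Measure.restrict k (@borel k (kTop p k)) volk
          {z : k | absk p k z ≤ (q 1 : ℝ) ^ (-⌊(-(N : ℝ)) / (e n : ℝ)⌋)} := by
  have hnormpow (j : ℕ) (x : Kn j) :
      Knorm x ^ (finrank k (Kn j) : ℝ) = absk p k (Algebra.norm k x) := by
    have h0 : 0 ≤ absk p k (Algebra.norm k x) := norm_nonneg _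
    have hM : (finrank k (Kn j) : ℝ) ≠ 0 := by
      exact_mod_cast (finrank_pos (R := k) (M := Kn j)).ne'
    rw [hKnorm j x x.2]
    exact Real.rpow_inv_rpow h0 hM
  have hfin1 : finrank k (Kn 1) = 1 := by rw [hbot]; exact IntermediateField.finrank_bot
  have hQ : IsGreatest {r : ℝ | (∃ x : k, absk p k x = r) ∧ r < 1} ((q 1 : ℝ)⁻¹) := by
    convert hq 1 using 1
    ext r
    simp only [Set.mem_ofPred_eq, hnormpow]
    refine and_congr_left fun _ ↦ ⟨?_, fun ⟨x, hx⟩ ↦ ⟨_, hx⟩⟩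
    rintro ⟨x, hx⟩
    exact ⟨algebraMap k (Kn 1) x, by rw [Algebra.norm_algebraMap, hfin1, pow_one, hx]⟩
  obtain ⟨hqf, hef'⟩ := hef n
  have hM : 0 < finrank k (Kn n) := finrank_pos
  have he : 0 < e n := Nat.pos_of_mul_pos_right (hef' ▸ hM)
  have hf : 0 < f n := Nat.pos_of_mul_pos_left (hef' ▸ hM)
  set m : ℤ := ⌊(-(N : ℝ)) / (e n : ℝ)⌋ with hm
  obtain ⟨hQ1, hzpow⟩ := one_lt_and_exists_absk_eq_zpow hQ
  have hQ0 : 0 < (q 1 : ℝ) := one_pos.trans hQ1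
  have hsmul (c : k) (x : ProjLim k K Kn T) : pairing (c • a) x = c * pairing a x := by
    rw [hpair n (c • a) ((Kn n).smul_mem ha) x, hpair n a ha x]
    have h1 : (⟨c • a * x.1 n, mul_mem ((Kn n).smul_mem ha) (x.2.1 n)⟩ : Kn n) =
        c • ⟨a * x.1 n, mul_mem ha (x.2.1 n)⟩ := Subtype.ext (smul_mul_assoc c a (x.1 n))
    rw [h1, _root_.map_smul, smul_eq_mul, mul_left_comm]
  have hball (c : k) : Knorm (c • a) ≤ 1 ↔ absk p k c ≤ (q 1 : ℝ) ^ m := by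
    have h0 : 0 ≤ Knorm (c • a) := by
      rw [hKnorm n _ ((Kn n).smul_mem ha)]
      exact Real.rpow_nonneg (norm_nonneg _) _
    have h1 : Knorm (c • a) ^ finrank k (Kn n) =
        absk p k c ^ finrank k (Kn n) * (q n : ℝ) ^ N := by
      have h2 := hnormpow n (c • ⟨a, ha⟩)
      have h3 := hnormpow n ⟨a, ha⟩
      have h4 : Algebra.norm k (c • (⟨a, ha⟩ : Kn n)) =
          c ^ finrank k (Kn n) * Algebra.norm k (⟨a, ha⟩ : Kn n) := by
        rw [Algebra.smul_def, map_mul, Algebra.norm_algebraMap]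
      rw [h4] at h2
      rw [← hN, h3, ← Real.rpow_natCast]
      refine h2.trans ?_
      simp only [absk, map_mul, map_pow, norm_mul, norm_pow]
    rw [← pow_le_one_iff_of_nonneg h0 hM.ne', h1]
    rcases eq_or_ne c 0 with rfl | hc
    · have h2 : absk p k 0 = 0 := by simp [absk, Algebra.norm_zero]
      rw [h2, zero_pow hM.ne', zero_mul]
      exact iff_of_true zero_le_one (zpow_pos hQ0 m).le
    · obtain ⟨v, hv⟩ := hzpow c hc
      rw [hv, hqf, hef', Nat.cast_pow, ← zpow_natCast, ← zpow_natCast, ← zpow_mul, ← zpow_mul,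
        ← zpow_add₀ hQ0.ne', zpow_le_one_iff_right₀ hQ1, zpow_le_zpow_iff_right₀ hQ1, hm,
        Int.le_floor, le_div_iff₀ (by exact_mod_cast he)]
      have h2 : v * ((e n * f n : ℕ) : ℤ) + (f n : ℤ) * N = (f n : ℤ) * (v * e n + N) := by
        push_cast; ring
      have hf' : (0 : ℤ) < f n := by exact_mod_cast hf
      have h3 : (v : ℝ) * e n ≤ -N ↔ v * e n ≤ -N := by exact_mod_cast Iff.rfl
      rw [h2, h3, le_neg_iff_add_nonpos_right, ← not_lt, mul_pos_iff_of_pos_left hf', not_lt]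
  have hcont : @Continuous _ _ (projTop k K Kn T Knorm) (kTop p k) (pairing a) := by
    have h1 : pairing a = fun x ↦ (finrank k (Kn n) : k)⁻¹ *
        Algebra.trace k (Kn n) (⟨a * x.1 n, mul_mem ha (x.2.1 n)⟩ : Kn n) :=
      funext (hpair n a ha)
    rw [h1]
    exact continuous_pairing Knorm n (hKnorm n) _ ha
  let _ : TopologicalSpace k := kTop p k
  let _ : MeasurableSpace k := borel k
  have : BorelSpace k := ⟨rfl⟩
  let _ : TopologicalSpace (ProjLim k K Kn T) := projTop k K Kn T Knorm
  let _ : MeasurableSpace (ProjLim k K Kn T) := projMeas k K Kn T Knorm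
  have : BorelSpace (ProjLim k K Kn T) := ⟨rfl⟩
  have hmeas : Measurable (pairing a) := hcont.measurable
  refine measure_eq_smul_restrict_of_fourier hQ volk hvolkinv hvolknorm hχadd hχnorm hχcont
    hχtriv hχrank _ (Measure.isFiniteMeasure_map μ _) m fun c ↦ ?_
  have hmul : Continuous (fun z : k ↦ c * z) :=
    continuous_kTop_of_linearMap (LinearMap.mulLeft ℚ_[p] c)
  have hsm : AEStronglyMeasurable (fun z : k ↦ χ (c * z)) (Measure.map (pairing a) μ) :=
    (hχcont.comp hmul).measurable.aestronglyMeasurable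
  rw [integral_map hmeas.aemeasurable hsm]
  have h1 := hμchar (c • a)
  simp only [hsmul, hball] at h1
  exact h1
end

section
/- The measure μ is invariant with respect to additive shifts by elements of S: for every y ∈ S and every Borel set A ⊆ K̄, μ(A − y) = μ(A), where S = {x ∈ K̄ : ‖T_n(x)‖ ≤ q_n^{d_n/m_n}·‖m_n‖ for all n ≥ 1}. -/
open MeasureTheory Module
open scoped Classical

section GeneralLemmas

open BoundedContinuousFunction

/-- A family of unitary characters, indexed by an additive group, that separates the points of a
Polish space determines finite measures. -/
theorem measure_ext_of_integral_character_eq {X G : Type*} [TopologicalSpace X] [PolishSpace X]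
    [MeasurableSpace X] [BorelSpace X] [AddGroup G] (c : G → X → ℂ)
    (hcont : ∀ a, Continuous (c a)) (hnorm : ∀ a x, ‖c a x‖ = 1) (hzero : ∀ x, c 0 x = 1)
    (hadd : ∀ a b x, c (a + b) x = c a x * c b x)
    (hsep : ∀ x y, x ≠ y → ∃ a, c a x ≠ c a y)
    (μ ν : Measure X) [IsFiniteMeasure μ] [IsFiniteMeasure ν]
    (h : ∀ a, ∫ x, c a x ∂μ = ∫ x, c a x ∂ν) : μ = ν := by
  let e : G → (X →ᵇ ℂ) := fun a ↦
    BoundedContinuousFunction.ofNormedAddCommGroup (c a) (hcont a) 1 fun x ↦ (hnorm a x).le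
  have he : ∀ a x, e a x = c a x := fun _ _ ↦ rfl
  have hstar : ∀ a, star (e a) = e (-a) := by
    intro a
    ext x
    have h1 : c a x * c (-a) x = 1 := by rw [← hadd, add_neg_cancel, hzero]
    change star (c a x) = c (-a) x
    rw [eq_inv_of_mul_eq_one_right h1, Complex.inv_def, Complex.normSq_eq_norm_sq, hnorm]
    simp
  let B : Subalgebra ℂ (X →ᵇ ℂ) := (Submodule.span ℂ (Set.range e)).toSubalgebra
    (Submodule.subset_span ⟨0, by ext x; exact hzero x⟩) (by
      intro f g hf hg
      have := Submodule.mul_mem_mul hf hg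
      rw [Submodule.span_mul_span] at this
      refine Submodule.span_mono ?_ this
      rintro _ ⟨_, ⟨a, rfl⟩, _, ⟨b, rfl⟩, rfl⟩
      exact ⟨a + b, by ext x; exact hadd a b x⟩)
  let A : StarSubalgebra ℂ (X →ᵇ ℂ) :=
    { B with
      star_mem' := by
        intro f hf
        change f ∈ Submodule.span ℂ (Set.range e) at hf
        change star f ∈ Submodule.span ℂ (Set.range e)
        induction hf using Submodule.span_induction with
        | mem f hf =>
          obtain ⟨a, rfl⟩ := hf
          exact Submodule.subset_span ⟨-a, (hstar a).symm⟩
        | zero => simp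
        | add f g _ _ hf hg => rw [star_add]; exact add_mem hf hg
        | smul r f _ hf => rw [star_smul]; exact Submodule.smul_mem _ _ hf }
  refine ext_of_forall_mem_subalgebra_integral_eq_of_polish (𝕜 := ℂ) (A := A) ?_ ?_
  · intro x y hxy
    obtain ⟨a, ha⟩ := hsep x y hxy
    exact ⟨e a, ⟨toContinuousMapStarₐ ℂ (e a),
      ⟨e a, Submodule.subset_span ⟨a, rfl⟩, rfl⟩, rfl⟩, ha⟩
  · intro f hf
    change f ∈ Submodule.span ℂ (Set.range e) at hf
    induction hf using Submodule.span_induction with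
    | mem f hf => obtain ⟨a, rfl⟩ := hf; exact h a
    | zero => simp
    | add f g _ _ hf hg =>
      simp only [BoundedContinuousFunction.coe_add, Pi.add_apply]
      rw [integral_add (f.integrable μ) (g.integrable μ),
        integral_add (f.integrable ν) (g.integrable ν), hf, hg]
    | smul r f _ hf =>
      simp only [BoundedContinuousFunction.coe_smul, integral_smul, hf]

/-- A projective limit of finite-dimensional subspaces along linear maps is a Polish space. -/
theorem polishSpace_projLim {𝕜 E : Type*} [NontriviallyNormedField 𝕜] [LocallyCompactSpace 𝕜]
    [CompleteSpace 𝕜] [NormedAddCommGroup E] [NormedSpace 𝕜 E] (W : ℕ → Submodule 𝕜 E)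
    [∀ n, FiniteDimensional 𝕜 (W n)] (T : ℕ → E →ₗ[𝕜] E) :
    PolishSpace {x : ℕ → E // (∀ n, x n ∈ W n) ∧ ∀ ⦃n ν : ℕ⦄, n ≤ ν → T n (x ν) = x n} := by
  have (n : ℕ) : ProperSpace (W n) := FiniteDimensional.proper 𝕜 (W n)
  have (n : ℕ) : PolishSpace (W n) := inferInstance
  let g : {x : ℕ → E // (∀ n, x n ∈ W n) ∧ ∀ ⦃n ν : ℕ⦄, n ≤ ν → T n (x ν) = x n} →
    (∀ n, W n) := fun x n ↦ ⟨x.1 n, x.2.1 n⟩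
  let v : (∀ n, W n) → ℕ → E := fun x n ↦ x n
  have hg : Continuous g := continuous_pi fun n ↦
    ((continuous_apply n).comp continuous_subtype_val).subtype_mk _
  have hv : Continuous v := continuous_pi fun n ↦
    continuous_subtype_val.comp (continuous_apply n)
  refine Topology.IsClosedEmbedding.polishSpace (f := g)
    ⟨Topology.IsEmbedding.of_comp hg hv Topology.IsEmbedding.subtypeVal, ?_⟩
  have hrange : Set.range g =
      ⋂ (n : ℕ) (ν : ℕ) (_ : n ≤ ν), {x | T n (x ν : E) = (x n : E)} := by
    ext x
    simp only [Set.mem_range, Set.mem_iInter, Set.mem_ofPred_eq]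
    constructor
    · rintro ⟨x, rfl⟩ n ν h
      exact x.2.2 h
    · intro h
      exact ⟨⟨v x, fun n ↦ (x n).2, fun n ν hn ↦ h n ν hn⟩, rfl⟩
  rw [hrange]
  refine isClosed_iInter fun n ↦ isClosed_iInter fun ν ↦ isClosed_iInter fun _ ↦
    isClosed_eq ?_ (by fun_prop)
  have : Continuous ((T n).comp (W ν).subtype) := LinearMap.continuous_of_finiteDimensional _
  exact this.comp (continuous_apply ν)

/-- The norm of a finite extension of a complete nonarchimedean field is a power of the
spectral norm. -/
theorem norm_algebraNorm_eq_spectralNorm_pow {F L : Type*} [NontriviallyNormedField F]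
    [IsUltrametricDist F] [CompleteSpace F] [Field L] [Algebra F L] [FiniteDimensional F L]
    (x : L) : ‖Algebra.norm F x‖ = spectralNorm F L x ^ finrank F L := by
  have hx : IsIntegral F x := Algebra.IsIntegral.isIntegral x
  rw [Algebra.norm_eq_norm_adjoin, ← IntermediateField.adjoin.powerBasis_gen hx,
    Algebra.PowerBasis.norm_gen_eq_coeff_zero_minpoly, IntermediateField.adjoin.powerBasis_gen hx,
    IntermediateField.minpoly_gen, norm_pow, norm_mul, norm_pow, norm_neg, norm_one, one_pow,
    one_mul, spectralNorm.spectralNorm_eq_norm_coeff_zero_rpow, one_div,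
    ← Module.finrank_mul_finrank F (IntermediateField.adjoin F {x}) L, pow_mul,
    IntermediateField.adjoin.finrank hx, Real.rpow_inv_natCast_pow (norm_nonneg _)
      (minpoly.natDegree_pos hx).ne']

/-- A topology generated by balls for powers of norms of coordinates is the topology induced by
those coordinates. -/
theorem generateFrom_norm_pow_balls {X ι E : Type*} [SeminormedAddCommGroup E] (f : X → ι → E)
    (g : E → ℝ) {N : ℕ} (hN : N ≠ 0) (hg : ∀ z, g z = ‖z‖ ^ N) :
    TopologicalSpace.generateFrom {U : Set X | ∃ x : X, ∃ n : ι, ∃ ε : ℝ, 0 < ε ∧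
      U = {y : X | g (f y n - f x n) < ε}} = TopologicalSpace.induced f inferInstance := by
  apply le_antisymm
  · let t : TopologicalSpace X := TopologicalSpace.generateFrom {U : Set X | ∃ x : X, ∃ n : ι,
      ∃ ε : ℝ, 0 < ε ∧ U = {y : X | g (f y n - f x n) < ε}}
    refine continuous_iff_le_induced.1 (continuous_pi fun n ↦ ?_ : Continuous f)
    refine continuous_def.2 fun U hU ↦ isOpen_iff_mem_nhds.2 fun x hx ↦ ?_
    obtain ⟨ε, hε, hball⟩ := Metric.isOpen_iff.1 hU (f x n) hx
    refine mem_nhds_iff.2 ⟨{y | g (f y n - f x n) < ε ^ N}, ?_,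
      TopologicalSpace.isOpen_generateFrom_of_mem ⟨x, n, ε ^ N, by positivity, rfl⟩, ?_⟩
    · intro y hy
      apply hball
      rw [mem_ball_iff_norm]
      simp only [Set.mem_ofPred_eq, hg] at hy
      exact lt_of_pow_lt_pow_left₀ N hε.le hy
    · simp [hg, hN, hε]
  · refine le_generateFrom ?_
    rintro _ ⟨x, n, ε, _, rfl⟩
    let := TopologicalSpace.induced f inferInstance
    have hf : Continuous f := continuous_induced_dom
    simp only [hg]
    exact isOpen_lt (by fun_prop) continuous_const

end GeneralLemmas

theorem statement_10
    (p : ℕ) [Fact (Nat.Prime p)]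
    (k : Type) [Field k] [Algebra ℚ_[p] k] [FiniteDimensional ℚ_[p] k]
    (K : Type) [Field K] [Algebra k K] [CharZero K]
    (Kn : ℕ → IntermediateField k K)
    (hbot : Kn 1 = ⊥) (hmono : Monotone Kn)
    [hfd : ∀ n, FiniteDimensional k (Kn n)]
    (hunion : ∀ x : K, ∃ n, x ∈ Kn n)
    (T : ℕ → K →ₗ[k] K)
    (hTmem : ∀ (n : ℕ) (x : K), T n x ∈ Kn n)
    (hTdef : ∀ (n ν : ℕ) (h : n ≤ ν) (x : K) (hx : x ∈ Kn ν),
      T n x = ((finrank k (Kn n) : K) / (finrank k (Kn ν) : K)) *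
        (relTrace k K (Kn n) (Kn ν) (hmono h) ⟨x, hx⟩ : K))
    (Knorm : K → ℝ)
    (hKnorm : ∀ (n : ℕ) (x : K) (hx : x ∈ Kn n),
      Knorm x = absk p k (Algebra.norm k (⟨x, hx⟩ : Kn n)) ^ ((finrank k (Kn n) : ℝ)⁻¹))
    (pairing : K → ProjLim k K Kn T → k)
    (hpair : ∀ (n : ℕ) (a : K) (ha : a ∈ Kn n) (x : ProjLim k K Kn T),
      pairing a x = (finrank k (Kn n) : k)⁻¹ *
        Algebra.trace k (Kn n) (⟨a * x.1 n, mul_mem ha (x.2.1 n)⟩ : Kn n))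
    (q : ℕ → ℕ)
    (hq : ∀ n : ℕ, IsGreatest
      {r : ℝ | (∃ x : Kn n, Knorm ↑x ^ (finrank k (Kn n) : ℝ) = r) ∧ r < 1} ((q n : ℝ)⁻¹))
    (χ : k → ℂ)
    (hχadd : ∀ x y : k, χ (x + y) = χ x * χ y)
    (hχnorm : ∀ x : k, ‖χ x‖ = 1)
    (hχcont : @Continuous _ _ (kTop p k) _ χ)
    (hχtriv : ∀ x : k, absk p k x ≤ 1 → χ x = 1)
    (hχrank : ∃ x : k, absk p k x ≤ (q 1 : ℝ) ∧ χ x ≠ 1)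
    (d : ℕ → ℕ)
    (hd : ∀ (n : ℕ) (x : Kn n),
      Knorm ↑x ^ (finrank k (Kn n) : ℝ) ≤ (q n : ℝ) ^ (d n : ℝ) ↔
        ∀ y : Kn n, Knorm ↑y ≤ 1 → absk p k (Algebra.trace k (Kn n) (x * y)) ≤ 1)
    (μ : @MeasureTheory.Measure (ProjLim k K Kn T) (projMeas k K Kn T Knorm))
    (hμprob : MeasureTheory.IsProbabilityMeasure μ)
    (hμradon : ∀ A : Set (ProjLim k K Kn T), MeasurableSet[projMeas k K Kn T Knorm] A →
      μ A = ⨆ (C : Set (ProjLim k K Kn T))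
        (_ : C ⊆ A ∧ @IsCompact _ (projTop k K Kn T Knorm) C), μ C)
    (hμchar : ∀ a : K, ∫ x, χ (pairing a x) ∂μ = if Knorm a ≤ 1 then (1 : ℂ) else 0)
    :
    ∀ y ∈ {x : ProjLim k K Kn T | ∀ n : ℕ, 1 ≤ n → Knorm (x.1 n) ≤ (q n : ℝ) ^ ((d n : ℝ) / (finrank k (Kn n) : ℝ)) * absk p k (finrank k (Kn n) : k)},
      ∀ A : Set (ProjLim k K Kn T), MeasurableSet[projMeas k K Kn T Knorm] A →
        μ {x : ProjLim k K Kn T | pladd k K Kn T x y ∈ A} = μ A := by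
  intro y hy A hA
  let : Algebra ℚ_[p] K := ((algebraMap k K).comp (algebraMap ℚ_[p] k)).toAlgebra
  have : IsScalarTower ℚ_[p] k K := IsScalarTower.of_algebraMap_eq' rfl
  have (n : ℕ) : FiniteDimensional ℚ_[p] (Kn n) := FiniteDimensional.trans ℚ_[p] k (Kn n)
  have (n : ℕ) : IsScalarTower ℚ_[p] (Kn n) K := IsScalarTower.of_algebraMap_eq fun _ ↦ rfl
  have : Algebra.IsAlgebraic ℚ_[p] K := ⟨fun x ↦ by
    obtain ⟨n, hn⟩ := hunion x
    exact (Algebra.IsAlgebraic.isAlgebraic (R := ℚ_[p]) (⟨x, hn⟩ : Kn n)).algebraMap (A := K)⟩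
  let : NormedField K := spectralNorm.normedField ℚ_[p] K
  let : NormedAlgebra ℚ_[p] K := spectralNorm.normedAlgebra ℚ_[p] K
  set N := finrank ℚ_[p] k with hN
  have hN0 : N ≠ 0 := finrank_pos.ne'
  have hcast (n : ℕ) : (finrank k (Kn n) : k) ≠ 0 := by
    have : CharZero k := charZero_of_injective_algebraMap (algebraMap ℚ_[p] k).injective
    exact_mod_cast (finrank_pos (R := k) (M := Kn n)).ne'
  have hnormK (x : K) : ‖x‖ = spectralNorm ℚ_[p] K x := rfl
  have habsk (c : k) : absk p k c = ‖algebraMap k K c‖ ^ N := by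
    rw [absk, norm_algebraNorm_eq_spectralNorm_pow, hnormK, spectralNorm.eq_of_tower (L := K) c]
  have hKnorm' (x : K) : Knorm x = ‖x‖ ^ N := by
    obtain ⟨n, hn⟩ := hunion x
    have hm : finrank k (Kn n) ≠ 0 := finrank_pos.ne'
    rw [hKnorm n x hn, absk, Algebra.norm_norm, norm_algebraNorm_eq_spectralNorm_pow, hnormK,
      ← Module.finrank_mul_finrank ℚ_[p] k (Kn n), pow_mul,
      Real.pow_rpow_inv_natCast (pow_nonneg (spectralNorm_nonneg _) _) hm,
      spectralNorm.eq_of_tower (L := K) (⟨x, hn⟩ : Kn n)]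
    rfl
  let W (n : ℕ) : Submodule ℚ_[p] K := (Kn n).toSubalgebra.toSubmodule.restrictScalars ℚ_[p]
  have (n : ℕ) : FiniteDimensional ℚ_[p] (W n) := inferInstanceAs (FiniteDimensional ℚ_[p] (Kn n))
  have hχ0 : χ 0 = 1 := hχtriv 0 (by simp [absk])
  let : TopologicalSpace (ProjLim k K Kn T) := projTop k K Kn T Knorm
  let : MeasurableSpace (ProjLim k K Kn T) := projMeas k K Kn T Knorm
  have : BorelSpace (ProjLim k K Kn T) := ⟨rfl⟩
  let coords (x : ProjLim k K Kn T) : ℕ → K := x.1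
  have htop : projTop k K Kn T Knorm = TopologicalSpace.induced coords inferInstance :=
    generateFrom_norm_pow_balls coords Knorm hN0 hKnorm'
  have hval : Topology.IsInducing coords := ⟨htop⟩
  have : PolishSpace (ProjLim k K Kn T) := by
    have : @PolishSpace (ProjLim k K Kn T) (TopologicalSpace.induced coords inferInstance) :=
      polishSpace_projLim W fun n ↦ (T n).restrictScalars ℚ_[p]
    rwa [← htop] at this
  have hcoord (n : ℕ) : Continuous (fun x : ProjLim k K Kn T ↦ x.1 n) :=
    (continuous_apply n).comp hval.continuous
  have hadd : Continuous (fun x ↦ pladd k K Kn T x y) := by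
    rw [hval.continuous_iff]
    exact continuous_pi fun n ↦ (hcoord n).add continuous_const
  have hpcont (a : K) : @Continuous _ _ _ (kTop p k) (pairing a) := by
    obtain ⟨n, ha⟩ := hunion a
    let φ : W n →ₗ[ℚ_[p]] K :=
      { toFun := fun z ↦ algebraMap k K ((finrank k (Kn n) : k)⁻¹ *
          Algebra.trace k (Kn n) (⟨a, ha⟩ * ⟨z.1, z.2⟩))
        map_add' := by
          intro z w
          rw [← map_add, ← mul_add, ← map_add, ← mul_add]
          rfl
        map_smul' := by
          intro c z
          have : (⟨(c • z).1, (c • z).2⟩ : Kn n) = algebraMap ℚ_[p] k c • ⟨z.1, z.2⟩ := by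
            ext
            simp [Algebra.smul_def, IsScalarTower.algebraMap_apply ℚ_[p] k K]
          rw [this, mul_smul_comm, _root_.map_smul, smul_eq_mul, mul_left_comm, map_mul,
            ← IsScalarTower.algebraMap_apply, ← Algebra.smul_def, RingHom.id_apply] }
    have hφ : Continuous φ := LinearMap.continuous_of_finiteDimensional φ
    have hφp : Continuous (fun x ↦ algebraMap k K (pairing a x)) := by
      have : (fun x ↦ algebraMap k K (pairing a x)) =
          fun x : ProjLim k K Kn T ↦ φ ⟨x.1 n, x.2.1 n⟩ := by
        ext x
        rw [hpair n a ha x]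
        rfl
      rw [this]
      exact hφ.comp ((hcoord n).subtype_mk _)
    refine continuous_generateFrom_iff.2 ?_
    rintro _ ⟨c, ε, _, rfl⟩
    simp only [Set.preimage_ofPred_eq, habsk, map_sub]
    exact isOpen_lt (by fun_prop) continuous_const
  let c (a : K) (x : ProjLim k K Kn T) : ℂ := χ (pairing a x)
  have hccont (a : K) : Continuous (c a) :=
    @Continuous.comp _ _ _ _ (kTop p k) _ _ _ hχcont (hpcont a)
  have hpzero (x) : pairing 0 x = 0 := by
    rw [hpair 1 0 (zero_mem _) x]
    have : (⟨0 * x.1 1, mul_mem (zero_mem _) (x.2.1 1)⟩ : Kn 1) = 0 := by ext; simp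
    rw [this, map_zero, mul_zero]
  have hpadd (a b : K) (x) : pairing (a + b) x = pairing a x + pairing b x := by
    obtain ⟨i, hi⟩ := hunion a
    obtain ⟨j, hj⟩ := hunion b
    have ha := hmono (le_max_left i j) hi
    have hb := hmono (le_max_right i j) hj
    rw [hpair _ _ ha, hpair _ _ hb, hpair _ _ (add_mem ha hb), ← mul_add, ← map_add]
    congr 2
    ext
    simp [add_mul]
  have hpadd' (a : K) (x z) : pairing a (pladd k K Kn T x z) = pairing a x + pairing a z := by
    obtain ⟨n, ha⟩ := hunion a
    rw [hpair _ _ ha, hpair _ _ ha, hpair _ _ ha, ← mul_add, ← map_add]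
    congr 2
    ext
    simp [pladd, mul_add]
  have hsep (x z : ProjLim k K Kn T) (hxz : x ≠ z) : ∃ a, c a x ≠ c a z := by
    obtain ⟨n, hn⟩ : ∃ n, x.1 n ≠ z.1 n := by
      by_contra! h
      exact hxz (Subtype.ext (funext h))
    obtain ⟨b, -, hb⟩ := hχrank
    have hd0 : x.1 n - z.1 n ≠ 0 := sub_ne_zero.2 hn
    have ha : algebraMap k K b / (x.1 n - z.1 n) ∈ Kn n :=
      div_mem ((Kn n).algebraMap_mem b) (sub_mem (x.2.1 n) (z.2.1 n))
    have key : pairing (algebraMap k K b / (x.1 n - z.1 n)) x =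
        b + pairing (algebraMap k K b / (x.1 n - z.1 n)) z := by
      rw [← sub_eq_iff_eq_add, hpair n _ ha, hpair n _ ha, ← mul_sub, ← map_sub]
      have : ∀ h h', (⟨algebraMap k K b / (x.1 n - z.1 n) * x.1 n, h⟩ : Kn n) -
          ⟨algebraMap k K b / (x.1 n - z.1 n) * z.1 n, h'⟩ = algebraMap k (Kn n) b := by
        intro h h'
        ext
        change algebraMap k K b / (x.1 n - z.1 n) * x.1 n -
          algebraMap k K b / (x.1 n - z.1 n) * z.1 n = algebraMap k K b
        rw [← mul_sub, div_mul_cancel₀ _ hd0]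
      rw [this, Algebra.trace_algebraMap, nsmul_eq_mul, inv_mul_cancel_left₀ (hcast n)]
    refine ⟨algebraMap k K b / (x.1 n - z.1 n), fun h ↦ hb ?_⟩
    simp only [c] at h
    rw [key, hχadd] at h
    have hne : χ (pairing (algebraMap k K b / (x.1 n - z.1 n)) z) ≠ 0 := by
      rw [← norm_ne_zero_iff, hχnorm]
      exact one_ne_zero
    exact mul_eq_right₀ hne |>.1 h
  -- the shift does not change the characters of the unit ball
  have hytriv (a : K) (ha1 : Knorm a ≤ 1) : χ (pairing a y) = 1 := by
    obtain ⟨i, hi⟩ := hunion a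
    have hn1 : 1 ≤ max 1 i := le_max_left _ _
    have ha := hmono (le_max_right 1 i) hi
    generalize max 1 i = n at hn1 ha
    have hm : finrank k (Kn n) ≠ 0 := finrank_pos.ne'
    let w : Kn n := algebraMap k (Kn n) (finrank k (Kn n) : k)⁻¹ * ⟨y.1 n, y.2.1 n⟩
    have hyn := hy n hn1
    have hmpos : 0 < absk p k (finrank k (Kn n) : k) := by
      rw [habsk]
      have : algebraMap k K (finrank k (Kn n) : k) ≠ 0 :=
        (map_ne_zero _).2 (hcast n)
      positivity
    have hw : Knorm w = Knorm (y.1 n) / absk p k (finrank k (Kn n) : k) := by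
      have : (w : K) = (algebraMap k K (finrank k (Kn n) : k))⁻¹ * y.1 n := by
        rw [← map_inv₀]; rfl
      rw [hKnorm', hKnorm', habsk, this, norm_mul, norm_inv, mul_pow, inv_pow]
      field_simp
    have hwle : Knorm w ^ (finrank k (Kn n) : ℝ) ≤ (q n : ℝ) ^ (d n : ℝ) := by
      have h1 : Knorm w ≤ (q n : ℝ) ^ ((d n : ℝ) / (finrank k (Kn n) : ℝ)) := by
        rw [hw]
        exact (div_le_iff₀ hmpos).2 hyn
      have h0 : 0 ≤ Knorm w := by rw [hKnorm']; positivity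
      refine (Real.rpow_le_rpow h0 h1 (by positivity)).trans_eq ?_
      rw [← Real.rpow_mul (by positivity), div_mul_cancel₀ _ (by exact_mod_cast hm)]
    have htr := (hd n w).1 hwle ⟨a, ha⟩ ha1
    apply hχtriv
    rw [hpair n a ha]
    convert htr using 2
    rw [← smul_eq_mul, ← _root_.map_smul, Algebra.smul_def]
    congr 1
    ext
    simp only [w, MulMemClass.coe_mul]
    ring
  have hmap : μ.map (fun x ↦ pladd k K Kn T x y) = μ := by
    have : IsProbabilityMeasure (μ.map fun x ↦ pladd k K Kn T x y) :=
      Measure.isProbabilityMeasure_map hadd.aemeasurable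
    refine measure_ext_of_integral_character_eq c hccont (fun a x ↦ hχnorm _)
      (fun x ↦ by simp only [c, hpzero, hχ0]) (fun a b x ↦ by simp only [c, hpadd, hχadd])
      hsep _ _ fun a ↦ ?_
    rw [integral_map hadd.aemeasurable (hccont a).aestronglyMeasurable]
    simp only [c, hpadd', hχadd]
    rw [integral_mul_const, hμchar]
    split_ifs with ha
    · rw [hytriv a ha, one_mul]
    · rw [zero_mul]
  calc μ {x | pladd k K Kn T x y ∈ A} = μ.map (fun x ↦ pladd k K Kn T x y) A :=
        (Measure.map_apply hadd.measurable hA).symm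
    _ = μ A := by rw [hmap]
end
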